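/- Let k > 0 be an integer, let Γ₁,…,Γ_k be finite nilpotent groups, and let Γ be an abelian group that can be generated by r elements. Let φ : Γ₁ × ⋯ × Γ_k → Γ be a map that is a homomorphism in each variable. Then the subgroup generated by the image set φ(Γ₁,…,Γ_k) := {φ(g₁,…,g_k) : gᵢ ∈ Γᵢ} satisfies ⟨φ(Γ₁,…,Γ_k)⟩ ⊆ φ(Γ₁,…,Γ_k)^r, where the right-hand side denotes the r-fold product set. -/

import Mathlib

open Pointwise

section MultiHom

variable {ι : Type*} [DecidableEq ι] {H : ι → Type*} [∀ i, Group (H i)]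
  {G : Type*} [AddCommGroup G]

/-- `f` turns products into sums in each variable separately. -/
def IsMultiHom (f : (∀ i, H i) → G) : Prop :=
  ∀ (i : ι) (x : ∀ j, H j) (a b : H i),
    f (Function.update x i (a * b)) = f (Function.update x i a) + f (Function.update x i b)

namespace IsMultiHom

variable {f : (∀ i, H i) → G}

lemma update_zpow (hf : IsMultiHom f) (i : ι) (x : ∀ j, H j) (a : H i) (n : ℤ) :
    f (Function.update x i (a ^ n)) = n • f (Function.update x i a) := by
  let F : H i →* Multiplicative G :=
    MonoidHom.mk' (fun a => Multiplicative.ofAdd (f (Function.update x i a)))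
      fun a b => by rw [hf, ofAdd_add]
  exact congrArg Multiplicative.toAdd (map_zpow F a n)

lemma exists_eq_zsmul (hf : IsMultiHom f) (i : ι) (x : ∀ j, H j) (n : ℤ) :
    ∃ y, f y = n • f x :=
  ⟨Function.update x i (x i ^ n), by rw [hf.update_zpow, Function.update_eq_self]⟩

lemma card_smul_eq_zero (hf : IsMultiHom f) (i : ι) (x : ∀ j, H j) :
    (Nat.card (H i) : ℤ) • f x = 0 := by
  have h := hf.update_zpow i x (x i) (Nat.card (H i))
  rw [Function.update_eq_self, zpow_natCast, pow_card_eq_one'] at h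
  rw [← h]
  have h0 := hf.update_zpow i x 1 0
  rwa [zero_smul, zpow_zero] at h0

/-- Changing every argument by an `m`-th power changes the value by a multiple of `m`. -/
lemma exists_sub_eq_smul [Fintype ι] (hf : IsMultiHom f) (m : ℤ) (x z w : ∀ i, H i)
    (h : ∀ i, z i = x i * w i ^ m) :
    ∃ c ∈ Submodule.span ℤ (Set.range f), f z - f x = m • c := by
  suffices H : ∀ s : Finset ι, ∃ c ∈ Submodule.span ℤ (Set.range f),
      f (s.piecewise z x) - f x = m • c by
    simpa using H Finset.univ
  intro s
  induction s using Finset.induction_on with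
  | empty => exact ⟨0, zero_mem _, by simp⟩
  | insert i s hi ih =>
    obtain ⟨c, hc, hcs⟩ := ih
    refine ⟨c + f (Function.update (s.piecewise z x) i (w i)),
      add_mem hc (Submodule.subset_span ⟨_, rfl⟩), ?_⟩
    have hx : Function.update (s.piecewise z x) i (x i) = s.piecewise z x := by
      conv_lhs => rw [← Finset.piecewise_eq_of_notMem s z x hi]
      exact Function.update_eq_self _ _
    rw [Finset.piecewise_insert, h i, hf, hf.update_zpow, hx, smul_add, ← hcs]
    abel

lemma exists_congr_of_isCoprime [Fintype ι] (hf : IsMultiHom f) {m n : ℤ} (hmn : IsCoprime m n)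
    (x y : ∀ i, H i) :
    ∃ z, (∃ c ∈ Submodule.span ℤ (Set.range f), f z - f x = m • c) ∧
      ∃ c ∈ Submodule.span ℤ (Set.range f), f z - f y = n • c := by
  obtain ⟨a, b, hab⟩ := hmn
  refine ⟨fun i => x i * (((x i)⁻¹ * y i) ^ a) ^ m,
    hf.exists_sub_eq_smul m x _ (fun i => ((x i)⁻¹ * y i) ^ a) fun _ => rfl,
    hf.exists_sub_eq_smul n y _ (fun i => ((x i)⁻¹ * y i) ^ (-b)) fun i => ?_⟩
  have ham : a * m = 1 + -b * n := by linear_combination hab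
  rw [← zpow_mul, ← zpow_mul, ham, zpow_add, zpow_one, ← mul_assoc, mul_inv_cancel_left]

lemma exists_congr_primes [Fintype ι] (hf : IsMultiHom f) (S : Finset ℕ)
    (hS : ∀ p ∈ S, p.Prime) (x : ℕ → ∀ i, H i) :
    ∃ y, ∀ p ∈ S, ∃ c ∈ Submodule.span ℤ (Set.range f), f y - f (x p) = (p : ℤ) • c := by
  induction S using Finset.induction_on with
  | empty => exact ⟨x 0, by simp⟩
  | insert q S hq ih =>
    obtain ⟨y, hy⟩ := ih fun p hp => hS p (Finset.mem_insert_of_mem hp)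
    have hcop : IsCoprime (q : ℤ) ((∏ p ∈ S, p : ℕ) : ℤ) := by
      refine Nat.isCoprime_iff_coprime.2 (Nat.Coprime.prod_right fun p hp => ?_)
      refine (Nat.coprime_primes (hS q (Finset.mem_insert_self _ _))
        (hS p (Finset.mem_insert_of_mem hp))).2 ?_
      rintro rfl
      exact hq hp
    obtain ⟨z, hzq, c, hc, hzc⟩ := hf.exists_congr_of_isCoprime hcop (x q) y
    refine ⟨z, fun p hp => ?_⟩
    obtain rfl | hp := Finset.mem_insert.1 hp
    · exact hzq
    obtain ⟨d, hd, hyd⟩ := hy p hp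
    obtain ⟨t, ht⟩ := Finset.dvd_prod_of_mem (fun p : ℕ => p) hp
    refine ⟨(t : ℤ) • c + d, add_mem (Submodule.smul_mem _ _ hc) hd, ?_⟩
    rw [ht, Nat.cast_mul, mul_smul] at hzc
    rw [smul_add, ← hzc, ← hyd]
    abel

end IsMultiHom

end MultiHom

/-- A subgroup of an abelian group generated by at most `r` elements is generated by at most `r`
elements. -/
lemma exists_fin_span_eq_of_span_eq_top {G : Type*} [AddCommGroup G] {r : ℕ} {S : Set G}
    (hS : S.Finite) (hr : S.ncard ≤ r) (htop : Submodule.span ℤ S = ⊤) (A : Submodule ℤ G) :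
    ∃ n ≤ r, ∃ g : Fin n → G, Submodule.span ℤ (Set.range g) = A := by
  have : Fintype S := hS.fintype
  let F := Fintype.linearCombination ℤ ((↑) : S → G)
  have hF : LinearMap.range F = ⊤ := by
    rw [Fintype.range_linearCombination, Subtype.range_coe, htop]
  let b := Module.finBasis ℤ (A.comap F)
  refine ⟨_, ?_, fun i => F (b i), ?_⟩
  · refine (Submodule.finrank_le _).trans ?_
    rwa [Module.finrank_fintype_fun_eq_card, ← Nat.card_eq_fintype_card,
      Nat.card_coe_set_eq]
  · have hb : Submodule.span ℤ (Set.range fun i => ((b i : A.comap F) : S → ℤ)) = A.comap F := by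
      have h := congrArg (Submodule.map (A.comap F).subtype) b.span_eq
      rwa [Submodule.map_span, ← Set.range_comp, Submodule.map_subtype_top] at h
    have h := congrArg (Submodule.map F) hb
    rwa [Submodule.map_span, ← Set.range_comp, Submodule.map_comap_eq, hF, top_inf_eq] at h

/-- If an abelian group is generated by at most `r` elements, then any of its quotients which is a
vector space over `ZMod p` is generated by the images of `r` elements of any given generating set
`X`. -/
lemma exists_fin_map_span_eq_top {M V : Type*} [AddCommGroup M] [AddCommGroup V] {p : ℕ}
    [Fact p.Prime] [Module (ZMod p) V] (π : M →ₗ[ℤ] V) (hπ : Function.Surjective π)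
    {X : Set M} (hX : X.Nonempty)
    (hspan : Submodule.span ℤ X = ⊤) {n r : ℕ} (hn : n ≤ r) (g : Fin n → M)
    (hg : Submodule.span ℤ (Set.range g) = ⊤) :
    ∃ x : Fin r → M, (∀ j, x j ∈ X) ∧ (Submodule.span ℤ (Set.range x)).map π = ⊤ := by
  have hres (s : Set V) : (Submodule.span (ZMod p) s).restrictScalars ℤ = Submodule.span ℤ s :=
    Submodule.restrictScalars_span ℤ (ZMod p) (ZMod.ringHom_surjective _) s
  have htop (s : Set M) (hs : Submodule.span ℤ s = ⊤) :
      Submodule.span (ZMod p) (π '' s) = ⊤ := by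
    rw [← Submodule.restrictScalars_eq_top_iff ℤ, hres, ← Submodule.map_span, hs,
      Submodule.map_top, LinearMap.range_eq_top.2 hπ]
  have hgV : Submodule.span (ZMod p) (Set.range (π ∘ g)) = ⊤ := by
    rw [Set.range_comp, htop _ hg]
  have : Module.Finite (ZMod p) V := ⟨hgV ▸ Submodule.fg_span (Set.finite_range _)⟩
  have hdim : Module.finrank (ZMod p) (Submodule.span (ZMod p) (π '' X)) ≤ r := by
    rw [htop X hspan, ← hgV]
    exact (finrank_range_le_card (R := ZMod p) (π ∘ g)).trans (by simpa using hn)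
  obtain ⟨v, hv, hvspan, -⟩ := Submodule.exists_fun_fin_finrank_span_eq (ZMod p) (π '' X)
  choose u hu huv using hv
  obtain ⟨x₀, hx₀⟩ := hX
  refine ⟨fun j => if h : (j : ℕ) < _ then u ⟨j, h⟩ else x₀, fun j => ?_, ?_⟩
  · dsimp only
    split_ifs
    exacts [hu _, hx₀]
  · rw [eq_top_iff, Submodule.map_span,
      ← (Submodule.restrictScalars_eq_top_iff ℤ _ _).2 (hvspan.trans (htop X hspan)), hres]
    refine Submodule.span_mono ?_
    rintro _ ⟨i, rfl⟩
    refine ⟨_, ⟨⟨i, i.2.trans_le hdim⟩, rfl⟩, ?_⟩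
    dsimp only
    rw [dif_pos i.2, huv]

/-- If an abelian group is generated by at most `r` elements, then modulo a prime it is generated
by `r` elements of any given generating set `X`. -/
lemma exists_fin_span_sup_eq_top {M : Type*} [AddCommGroup M] {X : Set M} (hX : X.Nonempty)
    (hspan : Submodule.span ℤ X = ⊤) {n r : ℕ} (hn : n ≤ r) (g : Fin n → M)
    (hg : Submodule.span ℤ (Set.range g) = ⊤) (p : ℕ) (hp : p.Prime) :
    ∃ x : Fin r → M, (∀ j, x j ∈ X) ∧
      Submodule.span ℤ (Set.range x) ⊔ LinearMap.range (LinearMap.lsmul ℤ M (p : ℤ)) = ⊤ := by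
  have := Fact.mk hp
  set P := LinearMap.range (LinearMap.lsmul ℤ M (p : ℤ))
  have hpV : ∀ v : M ⧸ P, p • v = 0 := by
    intro v
    obtain ⟨a, rfl⟩ := P.mkQ_surjective v
    rw [← map_nsmul]
    exact (Submodule.Quotient.mk_eq_zero _).2 ⟨a, by simp⟩
  let _ : Module (ZMod p) (M ⧸ P) := AddCommGroup.zmodModule hpV
  obtain ⟨x, hx, h⟩ :=
    exists_fin_map_span_eq_top (p := p) P.mkQ P.mkQ_surjective hX hspan hn g hg
  exact ⟨x, hx, by rwa [sup_comm, ← Submodule.map_mkQ_eq_top]⟩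

/-- If the span of `X` is generated by at most `r` elements, then modulo a prime it is generated by
`r` elements of `X`. -/
lemma exists_fin_span_mod_prime {G : Type*} [AddCommGroup G] {X : Set G} (hX : X.Nonempty)
    {n r : ℕ} (hn : n ≤ r) (g : Fin n → G)
    (hg : Submodule.span ℤ (Set.range g) = Submodule.span ℤ X) (p : ℕ) (hp : p.Prime) :
    ∃ x : Fin r → G, (∀ j, x j ∈ X) ∧ ∀ a ∈ Submodule.span ℤ X,
      ∃ b ∈ Submodule.span ℤ (Set.range x), ∃ c ∈ Submodule.span ℤ X, a = b + (p : ℤ) • c := by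
  have hgA (i : Fin n) : g i ∈ Submodule.span ℤ X := hg ▸ Submodule.subset_span ⟨i, rfl⟩
  obtain ⟨x₀, hx₀⟩ := hX
  obtain ⟨x, hx, hspan⟩ := exists_fin_span_sup_eq_top
    (X := ((↑) : Submodule.span ℤ X → G) ⁻¹' X) ⟨⟨x₀, Submodule.subset_span hx₀⟩, hx₀⟩
    Submodule.span_span_coe_preimage hn (fun i => ⟨g i, hgA i⟩)
    (by
      apply Submodule.map_injective_of_injective (Submodule.span ℤ X).injective_subtype
      rw [Submodule.map_span, ← Set.range_comp, Submodule.map_subtype_top]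
      exact hg) p hp
  refine ⟨fun j => x j, hx, fun a ha => ?_⟩
  obtain ⟨b, hb, _, ⟨c, rfl⟩, hbc⟩ := Submodule.mem_sup.1
    (hspan ▸ Submodule.mem_top : (⟨a, ha⟩ : Submodule.span ℤ X) ∈ _)
  refine ⟨b, ?_, c, c.2, (congrArg Subtype.val hbc).symm⟩
  have h := Submodule.mem_map_of_mem (f := (Submodule.span ℤ X).subtype) hb
  rwa [Submodule.map_span, ← Set.range_comp] at h

/-- Nakayama-type descent: a subgroup killed by `e` is contained in any subgroup which
generates it modulo each prime divisor of `e`. -/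
lemma le_of_forall_prime_dvd {G : Type*} [AddCommGroup G] (A N : Submodule ℤ G) {e : ℕ}
    (he : e ≠ 0) (hA : ∀ a ∈ A, (e : ℤ) • a = 0)
    (h : ∀ p : ℕ, p.Prime → p ∣ e → ∀ a ∈ A, ∃ b ∈ N, ∃ c ∈ A, a = b + (p : ℤ) • c) :
    A ≤ N := by
  have key : ∀ d : ℕ, d ∣ e → ∀ a ∈ A, ∃ b ∈ N, ∃ c ∈ A, a = b + (d : ℤ) • c := by
    intro d
    induction d using induction_on_primes with
    | zero => exact fun h0 => absurd (zero_dvd_iff.1 h0) he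
    | one => exact fun _ a ha => ⟨0, zero_mem _, a, ha, by simp⟩
    | prime_mul p d hp ih =>
      intro hd a ha
      obtain ⟨b, hb, c, hc, rfl⟩ := ih ((Dvd.intro_left p rfl).trans hd) a ha
      obtain ⟨b', hb', c', hc', rfl⟩ := h p hp ((Dvd.intro d rfl).trans hd) c hc
      refine ⟨b + (d : ℤ) • b', add_mem hb (N.smul_mem _ hb'), c', hc', ?_⟩
      rw [smul_add, smul_smul, add_assoc, Nat.cast_mul, mul_comm (p : ℤ)]
  intro a ha
  obtain ⟨b, hb, c, hc, rfl⟩ := key e dvd_rfl a ha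
  rwa [hA c hc, add_zero]

lemma IsMultiHom.exists_fin_span_eq {ι : Type*} [DecidableEq ι] [Fintype ι] {H : ι → Type*}
    [∀ i, Group (H i)] {G : Type*} [AddCommGroup G] {f : (∀ i, H i) → G} (hf : IsMultiHom f)
    (i : ι) [Finite (H i)] {r : ℕ} {S : Set G} (hS : S.Finite) (hr : S.ncard ≤ r)
    (htop : Submodule.span ℤ S = ⊤) :
    ∃ y : Fin r → ∀ i, H i,
      Submodule.span ℤ (Set.range f) ≤ Submodule.span ℤ (Set.range fun j => f (y j)) := by
  obtain ⟨n, hn, g, hg⟩ :=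
    exists_fin_span_eq_of_span_eq_top hS hr htop (Submodule.span ℤ (Set.range f))
  have hmod : ∀ p : ℕ, ∃ x : Fin r → ∀ i, H i, p.Prime → ∀ a ∈ Submodule.span ℤ (Set.range f),
      ∃ b ∈ Submodule.span ℤ (Set.range fun j => f (x j)),
      ∃ c ∈ Submodule.span ℤ (Set.range f), a = b + (p : ℤ) • c := by
    intro p
    by_cases hp : p.Prime
    · obtain ⟨x, hx, h⟩ := exists_fin_span_mod_prime (Set.range_nonempty f) hn g hg p hp
      choose x' hx' using hx
      obtain rfl : (fun j => f (x' j)) = x := funext hx'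
      exact ⟨x', fun _ => h⟩
    · exact ⟨1, fun h => absurd h hp⟩
  choose x hx using hmod
  have he : Nat.card (H i) ≠ 0 := Nat.card_pos.ne'
  choose y hy using fun j => hf.exists_congr_primes (Nat.card (H i)).primeFactors
    (fun p => Nat.prime_of_mem_primeFactors) (fun p => x p j)
  refine ⟨y, le_of_forall_prime_dvd _ _ he ?_ fun p hp hpe a ha => ?_⟩
  · intro a ha
    induction ha using Submodule.span_induction with
    | mem _ h =>
      obtain ⟨x, rfl⟩ := h
      exact hf.card_smul_eq_zero i x
    | zero => simp
    | add a b _ _ ha hb => rw [smul_add, ha, hb, add_zero]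
    | smul n a _ ha => rw [smul_comm, ha, smul_zero]
  · obtain ⟨b, hb, c, hc, rfl⟩ := hx p hp a ha
    suffices hb' : ∃ b' ∈ Submodule.span ℤ (Set.range fun j => f (y j)),
        ∃ d ∈ Submodule.span ℤ (Set.range f), b = b' + (p : ℤ) • d by
      obtain ⟨b', hb', d, hd, rfl⟩ := hb'
      exact ⟨b', hb', d + c, add_mem hd hc, by rw [smul_add, add_assoc]⟩
    obtain ⟨t, rfl⟩ := (Submodule.mem_span_range_iff_exists_fun ℤ).1 hb
    choose d hd hyd using fun j => hy j p (Nat.mem_primeFactors.2 ⟨hp, hpe, he⟩)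
    refine ⟨∑ j, t j • f (y j), Submodule.sum_mem _ fun j _ => Submodule.smul_mem _ _
      (Submodule.subset_span ⟨j, rfl⟩), -∑ j, t j • d j, neg_mem <| Submodule.sum_mem _
      fun j _ => Submodule.smul_mem _ _ (hd j), ?_⟩
    rw [smul_neg, Finset.smul_sum, ← sub_eq_add_neg, ← Finset.sum_sub_distrib]
    refine Finset.sum_congr rfl fun j _ => ?_
    rw [smul_comm, ← hyd, ← smul_sub, sub_sub_cancel]

theorem image_of_multi_hom {k : ℕ} (hk : 0 < k) (Γi : Fin k → Type*)
    [∀ i, Group (Γi i)] [∀ i, Finite (Γi i)] [∀ i, Group.IsNilpotent (Γi i)]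
    (Γ : Type*) [CommGroup Γ] (r : ℕ)
    (hgen : ∃ S : Set Γ, S.Finite ∧ S.ncard ≤ r ∧ Subgroup.closure S = ⊤)
    (φ : (∀ i, Γi i) → Γ)
    (hhom : ∀ (i : Fin k) (x : ∀ j, Γi j) (a b : Γi i),
      φ (Function.update x i (a * b)) = φ (Function.update x i a) * φ (Function.update x i b)) :
    (Subgroup.closure (Set.range φ) : Set Γ) ⊆ (Set.range φ) ^ r := by
  obtain ⟨S, hS, hr, htop⟩ := hgen
  let f : (∀ i, Γi i) → Additive Γ := fun x => Additive.ofMul (φ x)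
  have hf : IsMultiHom f := fun i x a b => congrArg Additive.ofMul (hhom i x a b)
  have hclosure : ∀ (X : Set Γ) (a : Γ), a ∈ Subgroup.closure X →
      Additive.ofMul a ∈ Submodule.span ℤ (Additive.toMul ⁻¹' X) := by
    intro X a ha
    induction ha using Subgroup.closure_induction with
    | mem a h => exact Submodule.subset_span h
    | one => exact zero_mem _
    | mul a b _ _ ha hb => exact add_mem ha hb
    | inv a _ ha => exact neg_mem ha
  have hS' : (Additive.toMul ⁻¹' S).Finite := hS.preimage Additive.toMul.injective.injOn
  have hr' : (Additive.toMul ⁻¹' S).ncard ≤ r :=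
    (Set.ncard_preimage_of_injective_subset_range Additive.toMul.injective
      (by simp [Set.range_eq_univ.2 Additive.toMul.surjective])).trans_le hr
  have htop' : Submodule.span ℤ (Additive.toMul ⁻¹' S) = ⊤ :=
    eq_top_iff.2 fun a _ => hclosure S a.toMul (htop ▸ Subgroup.mem_top _)
  have i₀ : Fin k := ⟨0, hk⟩
  obtain ⟨y, hy⟩ := hf.exists_fin_span_eq i₀ hS' hr' htop'
  intro a ha
  have ha' : Additive.ofMul a ∈ Submodule.span ℤ (Set.range f) := hclosure (Set.range φ) a ha
  obtain ⟨t, ht⟩ := (Submodule.mem_span_range_iff_exists_fun ℤ).1 (hy ha')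
  choose z hz using fun j => hf.exists_eq_zsmul i₀ (y j) (t j)
  refine Set.mem_pow.2 ⟨fun j => ⟨φ (z j), z j, rfl⟩, ?_⟩
  rw [List.prod_ofFn]
  simp only [← hz] at ht
  exact congrArg Additive.toMul ht
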